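/- arXiv:2309.09367 — 6 statements merged into one kernel-verified Lean document; each statement's English description precedes it below -/
import Mathlib

section
/- Let 𝒳 be a compact topological space, let p ≥ 1 be an integer, and let M : 𝒳 → Matrix (Fin p) (Fin p) ℝ be continuous with M(x) symmetric positive semidefinite for every x ∈ 𝒳. Then there exists a design w* on 𝒳 with at most p(p+1)/2 support points such that det F(w*) ≥ det F(w) for every design w on 𝒳; that is, there exists a D-optimal design containing no more than p(p+1)/2 design points. -/
/-- A *design* on `𝒳`: a finitely supported weight function with nonnegative
weights summing to `1`. -/
def IsDesign {𝒳 : Type*} (w : 𝒳 →₀ ℝ) : Prop :=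
  (∀ x, 0 ≤ w x) ∧ w.sum (fun _ c => c) = 1

/-- The information matrix `F(w) = ∑ₓ w(x) • M(x)` of a design `w`. -/
noncomputable def infoMatrix {𝒳 : Type*} {p : ℕ} (M : 𝒳 → Matrix (Fin p) (Fin p) ℝ)
    (w : 𝒳 →₀ ℝ) : Matrix (Fin p) (Fin p) ℝ :=
  w.sum fun x c => c • M x

theorem infoMatrix_eq_lc {𝒳 : Type*} {p : ℕ} (M : 𝒳 → Matrix (Fin p) (Fin p) ℝ)
    (w : 𝒳 →₀ ℝ) : infoMatrix M w = Finsupp.linearCombination ℝ M w := by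
  rw [Finsupp.linearCombination_apply]; rfl

theorem isDesign_iff_lc {𝒳 : Type*} (w : 𝒳 →₀ ℝ) :
    IsDesign w ↔ (∀ x, 0 ≤ w x) ∧ Finsupp.linearCombination ℝ (fun _ : 𝒳 => (1 : ℝ)) w = 1 := by
  rw [Finsupp.linearCombination_apply]; simp [IsDesign]

/-- A symmetric matrix viewed as a function on unordered pairs. -/
def symVec {p : ℕ} (A : Matrix (Fin p) (Fin p) ℝ) (h : A.IsSymm) : Sym2 (Fin p) → ℝ :=
  Sym2.lift ⟨fun i j => A i j, fun i j => (h.apply i j).symm⟩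

/-- More than `p(p+1)/2` symmetric matrices are linearly dependent. -/
theorem exists_dep {𝒳 : Type*} {p : ℕ} (M : 𝒳 → Matrix (Fin p) (Fin p) ℝ)
    (hMsymm : ∀ x, (M x).IsSymm) (s : Finset 𝒳) (hs : p * (p + 1) / 2 < s.card) :
    ∃ c : 𝒳 →₀ ℝ, c.support ⊆ s ∧ c ≠ 0 ∧ Finsupp.linearCombination ℝ M c = 0 := by
  have h1 : ¬ LinearIndepOn ℝ (fun x => symVec (M x) (hMsymm x)) (s : Set 𝒳) := by
    intro h
    have := LinearIndependent.fintype_card_le_finrank h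
    rw [Module.finrank_fintype_fun_eq_card, Sym2.card, Fintype.card_fin, Nat.choose_two_right,
      Nat.add_sub_cancel, mul_comm] at this
    simp at this
    omega
  rw [linearIndepOn_iff] at h1
  push Not at h1
  obtain ⟨c, hc, h0, hne⟩ := h1
  refine ⟨c, by simpa [Finsupp.mem_supported] using hc, hne, ?_⟩
  ext i j
  have := congrFun h0 s(i, j)
  simp only [Finsupp.linearCombination_apply, Finsupp.sum, Finset.sum_apply, Pi.smul_apply,
    Matrix.sum_apply, Matrix.smul_apply, Pi.zero_apply, Matrix.zero_apply] at this ⊢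
  simpa [symVec] using this

/-- One reduction step. -/
theorem reduce_step {𝒳 : Type*} {p : ℕ} (hp : 1 ≤ p) (M : 𝒳 → Matrix (Fin p) (Fin p) ℝ)
    (hMsymm : ∀ x, (M x).IsSymm) (w : 𝒳 →₀ ℝ) (hw : IsDesign w)
    (hdet : 0 < (infoMatrix M w).det) (hs : p * (p + 1) / 2 < w.support.card) :
    ∃ w' : 𝒳 →₀ ℝ, IsDesign w' ∧ w'.support.card < w.support.card ∧
      (infoMatrix M w).det ≤ (infoMatrix M w').det := by
  classical
  obtain ⟨hw0, hw1⟩ := (isDesign_iff_lc w).1 hw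
  rw [infoMatrix_eq_lc] at hdet ⊢
  set S := Finsupp.linearCombination ℝ (fun _ : 𝒳 => (1 : ℝ)) with hS
  have hSsum : ∀ c : 𝒳 →₀ ℝ, S c = ∑ x ∈ c.support, c x := by
    intro c; rw [hS, Finsupp.linearCombination_apply]; simp [Finsupp.sum]
  -- a relation with nonnegative total and a positive coefficient
  obtain ⟨c, hcs, hc0, hSc, hpos⟩ : ∃ c : 𝒳 →₀ ℝ, c.support ⊆ w.support ∧
      Finsupp.linearCombination ℝ M c = 0 ∧ 0 ≤ S c ∧ ∃ x, 0 < c x := by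
    have key : ∀ c : 𝒳 →₀ ℝ, c ≠ 0 → 0 ≤ S c → ∃ x, 0 < c x := by
      intro c hc h
      by_contra! hcon
      apply hc
      rw [hSsum] at h
      have h2 : ∑ x ∈ c.support, c x = 0 :=
        le_antisymm (Finset.sum_nonpos fun x _ => hcon x) h
      have h3 := (Finset.sum_eq_zero_iff_of_nonpos fun x _ => hcon x).1 h2
      ext x
      by_cases hx : x ∈ c.support
      · exact h3 x hx
      · simpa using hx
    obtain ⟨c, hcs, hne, h0⟩ := exists_dep M hMsymm w.support hs
    rcases le_total 0 (S c) with h | h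
    · exact ⟨c, hcs, h0, h, key c hne h⟩
    · have h' : 0 ≤ S (-c) := by rw [map_neg]; linarith
      exact ⟨-c, by simpa using hcs, by rw [map_neg, h0, neg_zero], h',
        key (-c) (by simpa using hne) h'⟩
  obtain ⟨x1, hx1⟩ := hpos
  have hwpos : ∀ x, 0 < c x → 0 < w x := by
    intro x hx
    have : x ∈ w.support := hcs (by simpa using hx.ne')
    exact lt_of_le_of_ne (hw0 x) (Ne.symm (by simpa using this))
  obtain ⟨x0, hx0, hmin⟩ := Finset.exists_min_image (c.support.filter fun x => 0 < c x)
    (fun x => w x / c x) ⟨x1, by simp [hx1, hx1.ne']⟩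
  have hcx0 : 0 < c x0 := (Finset.mem_filter.1 hx0).2
  set t := w x0 / c x0 with ht
  have htpos : 0 < t := div_pos (hwpos x0 hcx0) hcx0
  set v := w - t • c with hv
  have hvx : ∀ x, v x = w x - t * c x := by intro x; simp [hv]
  have hv0 : ∀ x, 0 ≤ v x := by
    intro x
    rw [hvx]
    rcases lt_or_ge 0 (c x) with h | h
    · have := hmin x (by simp [h, h.ne'])
      rw [le_div_iff₀ h] at this
      linarith
    · nlinarith [hw0 x]
  have hvx0 : v x0 = 0 := by
    rw [hvx, ht]; field_simp; ring
  have hvsupp : v.support ⊂ w.support := by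
    rw [Finset.ssubset_iff_of_subset]
    · exact ⟨x0, by simpa using (hwpos x0 hcx0).ne', by simpa using hvx0⟩
    · intro x hx
      by_contra hxw
      have h1 : w x = 0 := by simpa using hxw
      have h2 : c x = 0 := by
        by_contra h; exact hxw (hcs (by simpa using h))
      rw [Finsupp.mem_support_iff, hvx, h1, h2] at hx
      simp at hx
  have hFv : Finsupp.linearCombination ℝ M v = Finsupp.linearCombination ℝ M w := by
    rw [hv, map_sub, map_smul, hc0, smul_zero, sub_zero]
  have hSv : S v = 1 - t * S c := by rw [hv, map_sub, map_smul, hw1, smul_eq_mul]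
  have hSle : S v ≤ 1 := by rw [hSv]; nlinarith
  have hSpos : 0 < S v := by
    have hnn : 0 ≤ S v := by rw [hSsum]; exact Finset.sum_nonneg fun x _ => hv0 x
    refine lt_of_le_of_ne hnn fun h => ?_
    rw [hSsum] at h
    have h3 := (Finset.sum_eq_zero_iff_of_nonneg fun x _ => hv0 x).1 h.symm
    have hvz : v = 0 := by
      ext x
      by_cases hx : x ∈ v.support
      · exact h3 x hx
      · simpa using hx
    have : Nonempty (Fin p) := ⟨⟨0, hp⟩⟩
    rw [← hFv, hvz, map_zero, Matrix.det_zero] at hdet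
    exact lt_irrefl _ hdet
  refine ⟨(S v)⁻¹ • v, (isDesign_iff_lc _).2 ⟨fun x => ?_, ?_⟩, ?_, ?_⟩
  · simpa using mul_nonneg (inv_nonneg.2 hSpos.le) (hv0 x)
  · rw [← hS, map_smul, smul_eq_mul, inv_mul_cancel₀ hSpos.ne']
  · exact lt_of_le_of_lt (Finset.card_le_card Finsupp.support_smul) (Finset.card_lt_card hvsupp)
  · rw [infoMatrix_eq_lc, map_smul, hFv, Matrix.det_smul]
    exact le_mul_of_one_le_left hdet.le (one_le_pow₀ ((one_le_inv₀ hSpos).2 hSle))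

theorem reduce {𝒳 : Type*} {p : ℕ} (hp : 1 ≤ p) (M : 𝒳 → Matrix (Fin p) (Fin p) ℝ)
    (hMsymm : ∀ x, (M x).IsSymm) (n : ℕ) : ∀ (w : 𝒳 →₀ ℝ), IsDesign w →
    0 < (infoMatrix M w).det → w.support.card = n →
    ∃ w' : 𝒳 →₀ ℝ, IsDesign w' ∧ w'.support.card ≤ p * (p + 1) / 2 ∧
      (infoMatrix M w).det ≤ (infoMatrix M w').det := by
  induction n using Nat.strong_induction_on with
  | _ n ih =>
    intro w hw hdet hn
    by_cases hs : w.support.card ≤ p * (p + 1) / 2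
    · exact ⟨w, hw, hs, le_rfl⟩
    · obtain ⟨w1, h1, h2, h3⟩ := reduce_step hp M hMsymm w hw hdet (not_le.1 hs)
      obtain ⟨w2, h4, h5, h6⟩ := ih _ (hn ▸ h2) w1 h1 (hdet.trans_le h3) rfl
      exact ⟨w2, h4, h5, h3.trans h6⟩

/-- The design with weights `a` at the points `x`. -/
noncomputable def mkDesign {𝒳 : Type*} {N : ℕ} (a : Fin N → ℝ) (x : Fin N → 𝒳) : 𝒳 →₀ ℝ :=
  ∑ i, Finsupp.single (x i) (a i)

theorem lc_mkDesign {𝒳 V : Type*} [AddCommGroup V] [Module ℝ V] {N : ℕ} (a : Fin N → ℝ)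
    (x : Fin N → 𝒳) (f : 𝒳 → V) :
    Finsupp.linearCombination ℝ f (mkDesign a x) = ∑ i, a i • f (x i) := by
  simp [mkDesign, map_sum, Finsupp.linearCombination_single]

theorem isDesign_mkDesign {𝒳 : Type*} {N : ℕ} (a : Fin N → ℝ) (x : Fin N → 𝒳)
    (ha : a ∈ stdSimplex ℝ (Fin N)) : IsDesign (mkDesign a x) := by
  classical
  rw [isDesign_iff_lc, lc_mkDesign]
  refine ⟨fun y => ?_, by simpa using ha.2⟩
  rw [mkDesign, Finsupp.finsetSum_apply]
  refine Finset.sum_nonneg fun i _ => ?_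
  rw [Finsupp.single_apply]
  split_ifs
  · exact ha.1 i
  · exact le_rfl

theorem card_mkDesign {𝒳 : Type*} {N : ℕ} (a : Fin N → ℝ) (x : Fin N → 𝒳) :
    (mkDesign a x).support.card ≤ N := by
  classical
  have : (mkDesign a x).support ⊆ Finset.univ.image x := by
    refine (Finsupp.support_finsetSum).trans ?_
    intro y hy
    simp only [Finset.mem_biUnion] at hy
    obtain ⟨i, -, hi⟩ := hy
    have := Finsupp.support_single_subset hi
    simp only [Finset.mem_singleton] at this
    simp [this]
  refine (Finset.card_le_card this).trans (Finset.card_image_le.trans ?_)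
  simp

theorem exists_rep {𝒳 : Type*} [Nonempty 𝒳] {p N : ℕ} (M : 𝒳 → Matrix (Fin p) (Fin p) ℝ)
    (w : 𝒳 →₀ ℝ) (hw : IsDesign w) (hN : w.support.card ≤ N) :
    ∃ a ∈ stdSimplex ℝ (Fin N), ∃ x : Fin N → 𝒳, infoMatrix M w = ∑ i, a i • M (x i) := by
  classical
  obtain ⟨e⟩ : Nonempty (w.support ↪ Fin N) :=
    Function.Embedding.nonempty_of_card_le (by simpa using hN)
  let a : Fin N → ℝ := Function.extend e (fun y => w y) 0
  let x : Fin N → 𝒳 := Function.extend e (fun y => (y : 𝒳)) fun _ => Classical.arbitrary 𝒳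
  have ha : ∀ y, a (e y) = w y := fun y => e.injective.extend_apply _ _ y
  have hx : ∀ y, x (e y) = y := fun y => e.injective.extend_apply _ _ y
  have ha' : ∀ i, i ∉ Set.range e → a i = 0 := by
    intro i hi
    exact Function.extend_apply' _ _ _ hi
  refine ⟨a, ⟨fun i => ?_, ?_⟩, x, ?_⟩
  · by_cases hi : i ∈ Set.range e
    · obtain ⟨y, rfl⟩ := hi
      rw [ha]; exact hw.1 _
    · rw [ha' i hi]
  · rw [← hw.2, Finsupp.sum, ← Finset.sum_coe_sort w.support]
    exact (Fintype.sum_of_injective e e.injective _ _ ha' fun y => (ha y).symm).symm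
  · rw [infoMatrix, Finsupp.sum, ← Finset.sum_coe_sort]
    refine Fintype.sum_of_injective e e.injective _ _ (fun i hi => ?_) fun y => ?_
    · rw [ha' i hi, zero_smul]
    · rw [ha, hx]

/-- There exists a D-optimal design supported on at most `p(p+1)/2` design points. -/
theorem exists_Doptimal_design_card_support_le
    {𝒳 : Type*} [TopologicalSpace 𝒳] [CompactSpace 𝒳] [Nonempty 𝒳]
    {p : ℕ} (hp : 1 ≤ p) (M : 𝒳 → Matrix (Fin p) (Fin p) ℝ)
    (hMcont : Continuous M) (hMsymm : ∀ x, (M x).IsSymm)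
    (hMpsd : ∀ x, (M x).PosSemidef) :
    ∃ w : 𝒳 →₀ ℝ, IsDesign w ∧ w.support.card ≤ p * (p + 1) / 2 ∧
      ∀ w' : 𝒳 →₀ ℝ, IsDesign w' → (infoMatrix M w').det ≤ (infoMatrix M w).det := by
  classical
  set N := p * (p + 1) / 2 with hN
  have hNpos : 0 < N := by
    have : 2 ≤ p * (p + 1) := by nlinarith
    omega
  have : Nonempty (Fin N) := ⟨⟨0, hNpos⟩⟩
  let K : Set ((Fin N → ℝ) × (Fin N → 𝒳)) := stdSimplex ℝ (Fin N) ×ˢ Set.univ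
  have hK : IsCompact K := (isCompact_stdSimplex ℝ (Fin N)).prod isCompact_univ
  have hKne : K.Nonempty :=
    ⟨(Pi.single ⟨0, hNpos⟩ 1, fun _ => Classical.arbitrary 𝒳),
      single_mem_stdSimplex ℝ _, Set.mem_univ _⟩
  have hcont : Continuous fun q : (Fin N → ℝ) × (Fin N → 𝒳) =>
      (∑ i, q.1 i • M (q.2 i)).det := by
    refine Continuous.matrix_det ?_
    fun_prop
  obtain ⟨⟨a, x⟩, hq, hmax⟩ := hK.exists_isMaxOn hKne hcont.continuousOn
  have hmain : ∀ w' : 𝒳 →₀ ℝ, IsDesign w' → w'.support.card ≤ N →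
      (infoMatrix M w').det ≤ (infoMatrix M (mkDesign a x)).det := by
    intro w' hw' hc
    obtain ⟨b, hb, y, hy⟩ := exists_rep M w' hw' hc
    rw [hy, infoMatrix_eq_lc, lc_mkDesign]
    exact hmax (show (b, y) ∈ K from ⟨hb, Set.mem_univ _⟩)
  refine ⟨mkDesign a x, isDesign_mkDesign a x hq.1, card_mkDesign a x, fun w' hw' => ?_⟩
  rcases lt_or_ge 0 (infoMatrix M w').det with h | h
  · obtain ⟨w2, h1, h2, h3⟩ := reduce hp M hMsymm _ w' hw' h rfl
    exact h3.trans (hmain w2 h1 h2)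
  · let x0 := Classical.arbitrary 𝒳
    have h1 := hmain (Finsupp.single x0 1) ?_ ?_
    · refine h.trans (le_trans ?_ h1)
      have : infoMatrix M (Finsupp.single x0 1) = M x0 := by
        simp [infoMatrix]
      rw [this]
      exact (hMpsd x0).det_nonneg
    · rw [isDesign_iff_lc]
      refine ⟨fun y => ?_, by simp⟩
      rw [Finsupp.single_apply]
      split_ifs <;> norm_num
    · exact (Finset.card_le_card Finsupp.support_single_subset).trans (by rw [Finset.card_singleton]; exact hNpos)
end

section
/- Let 𝒳 be a compact topological space, let p ≥ 1 be an integer, and let M : 𝒳 → Matrix (Fin p) (Fin p) ℝ be continuous with M(x) symmetric positive semidefinite for every x ∈ 𝒳. A design w on 𝒳 with det F(w) > 0 is D-optimal if and only if trace(F(w)⁻¹ · M(x)) ≤ p for every x ∈ 𝒳. -/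
open Matrix in
lemma det_le_one_of_trace_le {p : ℕ} (A : Matrix (Fin p) (Fin p) ℝ) (hA : A.PosSemidef)
    (ht : A.trace ≤ p) : A.det ≤ 1 := by
  have h1 := hA.1.det_eq_prod_eigenvalues
  have h2 := hA.1.trace_eq_sum_eigenvalues
  simp only [RCLike.ofReal_real_eq_id, id_eq] at h1 h2
  rw [h1]
  calc ∏ i, hA.1.eigenvalues i ≤ ∏ i, Real.exp (hA.1.eigenvalues i - 1) := by
        apply Finset.prod_le_prod
        · intro i _; exact hA.eigenvalues_nonneg i
        · intro i _
          have := Real.add_one_le_exp (hA.1.eigenvalues i - 1)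
          linarith
    _ = Real.exp (A.trace - p) := by
        rw [← Real.exp_sum, Finset.sum_sub_distrib, ← h2]; simp
    _ ≤ 1 := by
        rw [Real.exp_le_one_iff]; linarith

lemma infoMatrix_psd {𝒳 : Type*} {p : ℕ} (M : 𝒳 → Matrix (Fin p) (Fin p) ℝ)
    (hMpsd : ∀ x, (M x).PosSemidef) (w : 𝒳 →₀ ℝ) (hw : IsDesign w) :
    (infoMatrix M w).PosSemidef := by
  unfold infoMatrix Finsupp.sum
  exact Matrix.posSemidef_sum _ fun x _ => (hMpsd x).smul (hw.1 x)

open scoped MatrixOrder Matrix.Norms.L2Operator in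
lemma exists_conj_factor {p : ℕ} (A : Matrix (Fin p) (Fin p) ℝ) (hA : A.PosSemidef) :
    ∃ B : Matrix (Fin p) (Fin p) ℝ, A = B.conjTranspose * B :=
  CStarAlgebra.nonneg_iff_eq_star_mul_self.mp hA.nonneg

lemma det_le_of_trace_le {p : ℕ} (F G : Matrix (Fin p) (Fin p) ℝ) (hF : F.PosSemidef)
    (hG : G.PosSemidef) (hd : 0 < F.det) (ht : (F⁻¹ * G).trace ≤ p) : G.det ≤ F.det := by
  obtain ⟨B, hB⟩ := exists_conj_factor _ hF.inv
  have hA := hG.mul_mul_conjTranspose_same B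
  have h := det_le_one_of_trace_le _ hA (by
    rwa [Matrix.mul_assoc, Matrix.trace_mul_comm, Matrix.mul_assoc, ← hB,
      Matrix.trace_mul_comm])
  have h3 : F⁻¹.det * G.det ≤ 1 := by
    rw [hB, Matrix.det_mul]
    rw [Matrix.det_mul, Matrix.det_mul] at h
    linarith
  rw [Matrix.det_nonsing_inv, Ring.inverse_eq_inv', inv_mul_le_iff₀ hd] at h3
  linarith

lemma perturb {p : ℕ} (F N : Matrix (Fin p) (Fin p) ℝ) (hd : 0 < F.det)
    (h : ∀ t : ℝ, 0 < t → t < 1 → ((1 - t) • F + t • N).det ≤ F.det) :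
    (F⁻¹ * N).trace ≤ p := by
  set K := F⁻¹ * N - 1 with hK
  have htr : K.trace = (F⁻¹ * N).trace - p := by simp [hK, Matrix.trace_sub]
  have hu : IsUnit F.det := hd.ne'.isUnit
  set q := ((1 + (Polynomial.X : Polynomial ℝ) • K.map Polynomial.C).det).divX.divX with hq
  have hle : ∀ t : ℝ, 0 < t → t < 1 → K.trace + q.eval t * t ≤ 0 := by
    intro t h0 h1
    have e : (1 - t) • F + t • N = F * (1 + t • K) := by
      rw [hK, Matrix.mul_add, Matrix.mul_smul, Matrix.mul_sub,
        Matrix.mul_nonsing_inv_cancel_left _ _ hu]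
      simp only [Matrix.mul_one, smul_sub, sub_smul, one_smul]
      abel
    have := h t h0 h1
    rw [e, Matrix.det_mul, Matrix.det_one_add_smul, mul_le_iff_le_one_right hd] at this
    have h4 : t * (K.trace + q.eval t * t) ≤ 0 := by
      rw [hq]; linarith
    exact nonpos_of_mul_nonpos_right h4 h0
  have hlim : Filter.Tendsto (fun t : ℝ => K.trace + q.eval t * t) (nhdsWithin 0 (Set.Ioi 0))
      (nhds (K.trace + q.eval 0 * 0)) := by
    have : Continuous (fun t : ℝ => K.trace + q.eval t * t) := by fun_prop
    exact (this.tendsto 0).mono_left nhdsWithin_le_nhds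
  have := le_of_tendsto hlim (by
    filter_upwards [Ioo_mem_nhdsGT (zero_lt_one' ℝ)] with t ht using hle t ht.1 ht.2)
  linarith

lemma infoMatrix_mix {𝒳 : Type*} {p : ℕ} (M : 𝒳 → Matrix (Fin p) (Fin p) ℝ)
    (w : 𝒳 →₀ ℝ) (x : 𝒳) (t : ℝ) :
    infoMatrix M ((1 - t) • w + Finsupp.single x t) = (1 - t) • infoMatrix M w + t • M x := by
  classical
  unfold infoMatrix
  rw [Finsupp.sum_add_index' (by simp) (by intros; rw [add_smul]),
    Finsupp.sum_single_index (by simp), Finsupp.sum_smul_index (by simp), Finsupp.smul_sum]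
  simp only [mul_smul]

lemma isDesign_mix {𝒳 : Type*} (w : 𝒳 →₀ ℝ) (hw : IsDesign w) (x : 𝒳) (t : ℝ)
    (h0 : 0 < t) (h1 : t < 1) : IsDesign ((1 - t) • w + Finsupp.single x t) := by
  classical
  constructor
  · intro y
    have h2 := mul_nonneg (sub_nonneg.mpr h1.le) (hw.1 y)
    rw [Finsupp.add_apply, Finsupp.smul_apply, Finsupp.single_apply, smul_eq_mul]
    split_ifs <;> linarith
  · rw [Finsupp.sum_add_index' (by simp) (by intros; rfl),
      Finsupp.sum_single_index rfl, Finsupp.sum_smul_index (by simp), ← Finsupp.mul_sum, hw.2]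
    ring

/-- General equivalence theorem: a design `w` with `det F(w) > 0` is D-optimal
iff its sensitivity function `trace (F(w)⁻¹ * M x)` is at most `p` everywhere. -/
theorem Doptimal_iff_sensitivity_le
    {𝒳 : Type*} [TopologicalSpace 𝒳] [CompactSpace 𝒳]
    {p : ℕ} (hp : 1 ≤ p) (M : 𝒳 → Matrix (Fin p) (Fin p) ℝ)
    (hMcont : Continuous M) (hMsymm : ∀ x, (M x).IsSymm)
    (hMpsd : ∀ x, (M x).PosSemidef)
    (w : 𝒳 →₀ ℝ) (hw : IsDesign w) (hdet : 0 < (infoMatrix M w).det) :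
    (∀ w' : 𝒳 →₀ ℝ, IsDesign w' → (infoMatrix M w').det ≤ (infoMatrix M w).det) ↔
      ∀ x : 𝒳, ((infoMatrix M w)⁻¹ * M x).trace ≤ (p : ℝ) := by
  constructor
  · intro h x
    refine perturb _ _ hdet fun t h0 h1 => ?_
    rw [← infoMatrix_mix]
    exact h _ (isDesign_mix w hw x t h0 h1)
  · intro h w' hw'
    refine det_le_of_trace_le _ _ (infoMatrix_psd M hMpsd w hw) (infoMatrix_psd M hMpsd w' hw')
      hdet ?_
    have e : ((infoMatrix M w)⁻¹ * infoMatrix M w').trace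
        = ∑ x ∈ w'.support, w' x * ((infoMatrix M w)⁻¹ * M x).trace := by
      conv_lhs => rw [infoMatrix.eq_def M w']
      simp only [Finsupp.sum, Finset.mul_sum, Matrix.trace_sum, Matrix.mul_smul,
        Matrix.trace_smul, smul_eq_mul]
    rw [e]
    calc _ ≤ ∑ x ∈ w'.support, w' x * (p : ℝ) :=
          Finset.sum_le_sum fun x _ => mul_le_mul_of_nonneg_left (h x) (hw'.1 x)
      _ = p := by
          rw [← Finset.sum_mul]
          have := hw'.2
          rw [Finsupp.sum] at this
          rw [this, one_mul]
end

section
/- Let p ≥ 2 be an integer, let A be a p×p real symmetric positive semidefinite matrix with b := det A > 0, let u ∈ ℝ^p and c ≥ 0, and set B = c·u uᵀ. Define g(α) = det((1−α)·A + α·B) for α ∈ [0,1], and let d := det((A+B)/2) = g(1/2). Define α* = (2^p·d − (p+1)·b) / (p·(2^p·d − 2·b)) if 2^p·d > (p+1)·b, and α* = 0 otherwise. Then α* ∈ [0,1] and g(α*) ≥ g(α) for all α ∈ [0,1]; that is, α* maximizes g over [0,1]. -/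
open Matrix

lemma amgm_aux (n : ℕ) (y : ℝ) (hy : 0 ≤ y) : y ^ n * ((n : ℝ) + 1 - n * y) ≤ 1 := by
  induction n with
  | zero => simp
  | succ n ih =>
    have h2 : 0 ≤ (y - 1) * (y ^ (n + 1) - 1) := by
      rcases le_total y 1 with h | h
      · exact mul_nonneg_of_nonpos_of_nonpos (by linarith)
          (by linarith [pow_le_one₀ (n := n + 1) hy h])
      · exact mul_nonneg (by linarith) (by linarith [one_le_pow₀ (n := n + 1) h])
    have h3 := mul_le_mul_of_nonneg_left ih hy
    push_cast
    ring_nf at h2 h3 ⊢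
    linarith

lemma det_aux {n : ℕ} (hn : 1 ≤ n) (A : Matrix (Fin (n + 1)) (Fin (n + 1)) ℝ)
    (hb : 0 < A.det) (u : Fin (n + 1) → ℝ) (c t α : ℝ) :
    (t • A + α • (c • Matrix.vecMulVec u u)).det
      = A.det * (t ^ n * (t + α * (c * (u ⬝ᵥ A⁻¹ *ᵥ u)))) := by
  have hU : IsUnit A.det := isUnit_iff_ne_zero.mpr hb.ne'
  have key : t • A + α • (c • Matrix.vecMulVec u u)
      = A * (t • (1 : Matrix (Fin (n + 1)) (Fin (n + 1)) ℝ)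
          + Matrix.vecMulVec (A⁻¹ *ᵥ u) ((α * c) • u)) := by
    rw [Matrix.mul_add, Matrix.mul_vecMulVec, Matrix.mulVec_mulVec, Matrix.mul_nonsing_inv _ hU,
      Matrix.one_mulVec, Matrix.vecMulVec_smul, smul_smul]
    simp
  rw [key, Matrix.det_mul]
  congr 1
  rcases eq_or_ne t 0 with rfl | ht
  · have : Nontrivial (Fin (n + 1)) := Fin.nontrivial_iff_two_le.mpr (by omega)
    have : n ≠ 0 := by omega
    simp [Matrix.det_vecMulVec, this]
  · have h : t • (1 : Matrix (Fin (n + 1)) (Fin (n + 1)) ℝ)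
          + Matrix.vecMulVec (A⁻¹ *ᵥ u) ((α * c) • u)
        = t • (1 + Matrix.replicateCol Unit (A⁻¹ *ᵥ u)
            * Matrix.replicateRow Unit ((t⁻¹ * (α * c)) • u)) := by
      rw [← Matrix.vecMulVec_eq, smul_add, Matrix.vecMulVec_smul, Matrix.vecMulVec_smul, smul_smul,
        mul_inv_cancel_left₀ ht]
    rw [h, Matrix.det_smul, Matrix.det_one_add_replicateCol_mul_replicateRow, smul_dotProduct]
    simp only [Fintype.card_fin, smul_eq_mul]
    field_simp
    ring

/-- Optimal initial weight `α*` for a newly added design point: among all convex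
combinations `(1-α)A + αB` with `A` the current information matrix
(`b = det A > 0`) and `B = c·uuᵀ` the rank-one information at the new point,
the weight `α* = (2ᵖd - (p+1)b)/(p(2ᵖd - 2b))` (if `2ᵖd > (p+1)b`, else `0`)
maximizes the determinant, where `d = det((A+B)/2)`. -/
theorem optimal_initial_weight
    {p : ℕ} (hp : 2 ≤ p) (A : Matrix (Fin p) (Fin p) ℝ)
    (hA : A.PosSemidef) (hb : 0 < A.det)
    (u : Fin p → ℝ) (c : ℝ) (hc : 0 ≤ c)
    (B : Matrix (Fin p) (Fin p) ℝ) (hB : B = c • Matrix.vecMulVec u u)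
    (d : ℝ) (hd : d = (((1 : ℝ) / 2) • (A + B)).det)
    (αstar : ℝ)
    (hα : αstar = if (2 : ℝ) ^ p * d > ((p : ℝ) + 1) * A.det then
        ((2 : ℝ) ^ p * d - ((p : ℝ) + 1) * A.det) /
          ((p : ℝ) * ((2 : ℝ) ^ p * d - 2 * A.det))
      else 0) :
    αstar ∈ Set.Icc (0 : ℝ) 1 ∧
      ∀ α ∈ Set.Icc (0 : ℝ) 1,
        ((1 - α) • A + α • B).det ≤ ((1 - αstar) • A + αstar • B).det := by
  obtain ⟨n, rfl⟩ : ∃ n, p = n + 1 := ⟨p - 1, by omega⟩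
  have hn : 1 ≤ n := by omega
  subst hB
  have hs : 0 ≤ c * (u ⬝ᵥ A⁻¹ *ᵥ u) := by
    have := hA.inv.dotProduct_mulVec_nonneg u
    simp only [star_trivial] at this
    exact mul_nonneg hc this
  have hd' : (2 : ℝ) ^ (n + 1) * d = A.det * (1 + c * (u ⬝ᵥ A⁻¹ *ᵥ u)) := by
    rw [hd, smul_add, det_aux hn A hb]
    have : (2 : ℝ) ^ n * (1 / 2) ^ n = 1 := by rw [← mul_pow]; norm_num
    linear_combination (A.det * (1 + c * (u ⬝ᵥ A⁻¹ *ᵥ u))) * this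
  simp only [det_aux hn A hb]
  rw [hd'] at hα
  generalize c * (u ⬝ᵥ A⁻¹ *ᵥ u) = s at *
  generalize A.det = b at *
  have hn' : (1 : ℝ) ≤ n := by exact_mod_cast hn
  push_cast at hα
  split_ifs at hα with hcond
  · have hs1 : (n : ℝ) + 1 < s := by
      by_contra! h
      push_cast at hcond
      nlinarith
    have hk : 0 < s - 1 := by linarith
    have hs0 : 0 < s := by linarith
    have hn0 : (0 : ℝ) < n := by linarith
    have e : 1 - αstar = n * s / ((n + 1) * (s - 1)) := by
      have : b * (1 + s) - 2 * b = b * (s - 1) := by ring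
      rw [hα, this]
      field_simp
      ring
    have hT : 0 < n * s / ((n + 1) * (s - 1)) := by positivity
    have hT1 : n * s / ((n + 1) * (s - 1)) ≤ 1 := by
      rw [div_le_one (by positivity)]
      nlinarith
    refine ⟨⟨by linarith, by linarith⟩, ?_⟩
    rintro α ⟨h0, h1⟩
    apply mul_le_mul_of_nonneg_left _ hb.le
    set T := n * s / ((n + 1) * (s - 1)) with hTdef
    have hTs : T * (s - 1) = n * s / (n + 1) := by rw [hTdef]; field_simp
    obtain ⟨y, hy⟩ : ∃ y, 1 - α = T * y := ⟨(1 - α) / T, by field_simp⟩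
    have hy0 : 0 ≤ y := by
      by_contra! h
      nlinarith
    have a1 : 1 - α + α * s = s / (n + 1) * (n + 1 - n * y) := by
      have : 1 - α + α * s = s - (T * (s - 1)) * y := by
        linear_combination (1 - s) * hy
      rw [this, hTs]
      field_simp
    have a2 : 1 - αstar + αstar * s = s / (n + 1) := by
      have : 1 - αstar + αstar * s = s - (T * (s - 1)) := by
        linear_combination (1 - s) * e
      rw [this, hTs]
      field_simp
      ring
    rw [a1, a2, hy, e, mul_pow]
    have h5 : 0 ≤ T ^ n * (s / (n + 1)) := by positivity
    have h6 := mul_le_mul_of_nonneg_left (amgm_aux n y hy0) h5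
    linarith
  · have hs1 : s ≤ (n : ℝ) + 1 := by
      by_contra! h
      push_cast at hcond
      nlinarith
    subst hα
    refine ⟨by simp, ?_⟩
    rintro α ⟨h0, h1⟩
    apply mul_le_mul_of_nonneg_left _ hb.le
    have h6 := amgm_aux n (1 - α) (by linarith)
    have h7 : (1 - α) ^ n * (1 - α + α * s) ≤ (1 - α) ^ n * ((n : ℝ) + 1 - n * (1 - α)) := by
      apply mul_le_mul_of_nonneg_left _ (pow_nonneg (by linarith) n)
      nlinarith
    simpa using h7.trans h6
end

section
/- Let p ≥ 1 be an integer, let A be any p×p real matrix, let u, v ∈ ℝ^p, and set B = u·vᵀ (a rank-at-most-one matrix). Then for every real x, det((1−x)·A + x·B) = a·x·(1−x)^{p−1} + b·(1−x)^p, where b = det A and a = 2^p·det((A+B)/2) − det A. -/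
open Matrix

theorem det_add_smul_rank_one_affine {p : ℕ} (A : Matrix (Fin p) (Fin p) ℝ) (u v : Fin p → ℝ) :
    ∃ D : ℝ, ∀ t : ℝ, (A + t • Matrix.vecMulVec u v).det = A.det + t * D := by
  let M : Matrix (Fin p ⊕ Unit) (Fin p ⊕ Unit) ℝ :=
    fromBlocks A 0 (-replicateRow Unit v) 1
  refine ⟨(M.updateCol (Sum.inr ()) (Sum.elim u (0 : Unit → ℝ))).det, fun t => ?_⟩
  have h1 : (A + t • Matrix.vecMulVec u v).det =
      (M.updateCol (Sum.inr ()) ((Sum.elim (0 : Fin p → ℝ) (1 : Unit → ℝ)) + t • (Sum.elim u (0 : Unit → ℝ)))).det := by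
    have : M.updateCol (Sum.inr ()) ((Sum.elim (0 : Fin p → ℝ) (1 : Unit → ℝ)) + t • (Sum.elim u (0 : Unit → ℝ))) =
        fromBlocks A (t • replicateCol Unit u) (-replicateRow Unit v) 1 := by
      ext i j
      rcases i with i | i <;> rcases j with j | j <;> simp [M, updateCol_apply]
    rw [this, det_fromBlocks_one₂₂]
    congr 1
    ext i j
    simp [vecMulVec_apply, Matrix.mul_apply, mul_assoc]
  have h2 : M.updateCol (Sum.inr ()) (Sum.elim (0 : Fin p → ℝ) (1 : Unit → ℝ)) = M := by
    ext i j
    rcases i with i | i <;> rcases j with j | j <;> simp [M, updateCol_apply]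
  have h3 : M.det = A.det := by simp [M]
  rw [h1, det_updateCol_add, det_updateCol_smul, h2, h3]

/-- Along a lift-one direction toward a rank-one matrix `B = u vᵀ`, the
determinant of the convex combination is the polynomial
`a·x·(1-x)^(p-1) + b·(1-x)^p`, where `b = det A` and
`a = 2ᵖ·det((A+B)/2) - det A`. -/
theorem det_convex_combination_rank_one
    {p : ℕ} (hp : 1 ≤ p) (A : Matrix (Fin p) (Fin p) ℝ) (u v : Fin p → ℝ) (x : ℝ) :
    ((1 - x) • A + x • Matrix.vecMulVec u v).det =
      ((2 : ℝ) ^ p * (((1 : ℝ) / 2) • (A + Matrix.vecMulVec u v)).det - A.det) * x *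
          (1 - x) ^ (p - 1)
        + A.det * (1 - x) ^ p := by
  have h2 : (2 : ℝ) ^ p * (((1 : ℝ) / 2) • (A + Matrix.vecMulVec u v)).det =
      (A + Matrix.vecMulVec u v).det := by
    rw [det_smul, Fintype.card_fin, ← mul_assoc, ← mul_pow]
    norm_num
  rw [h2]
  obtain ⟨q, rfl⟩ : ∃ q, p = q + 1 := ⟨p - 1, by omega⟩
  rw [Nat.add_sub_cancel]
  by_cases hx : 1 - x = 0
  · have hx1 : x = 1 := by linarith
    subst hx1
    rcases q with _ | q
    · simp
    · have : (vecMulVec u v).det = 0 := det_vecMulVec u v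
      simp [this]
  · obtain ⟨D, hD⟩ := det_add_smul_rank_one_affine A u v
    have e1 := hD 1
    rw [one_smul] at e1
    have e2 : (1 - x) • A + x • vecMulVec u v = (1 - x) • (A + (x / (1 - x)) • vecMulVec u v) := by
      rw [smul_add, smul_smul, mul_div_cancel₀ _ hx]
    rw [e2, det_smul, hD, e1, Fintype.card_fin]
    field_simp
    ring
end

section
/- Let p ≥ 2 be an integer and let a ≥ 0 and b > 0 be real numbers. Define g(x) = a·x·(1−x)^{p−1} + b·(1−x)^p for x ∈ [0,1]. If a > p·b, then x* := (a − p·b)/(p·(a − b)) lies in (0,1) and satisfies g(x*) ≥ g(x) for all x ∈ [0,1]; if a ≤ p·b, then g(0) ≥ g(x) for all x ∈ [0,1]. -/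
theorem liftone_young (n : ℕ) (y t : ℝ) (hy : 0 ≤ y) (ht : 0 ≤ t) :
    y ^ n * ((n + 1) * t - n * y) ≤ t ^ (n + 1) := by
  induction n with
  | zero => simp
  | succ n ih =>
    have h1 := mul_le_mul_of_nonneg_left ih ht
    have h2 : 0 ≤ ((n : ℝ) + 1) * y ^ n * (y - t) ^ 2 := by positivity
    have e : y ^ (n + 1) * (((n + 1 : ℕ) + 1 : ℝ) * t - ((n + 1 : ℕ) : ℝ) * y)
        = t * (y ^ n * ((n + 1) * t - n * y)) - ((n : ℝ) + 1) * y ^ n * (y - t) ^ 2 := by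
      push_cast; ring
    have e2 : t ^ (n + 1 + 1) = t * t ^ (n + 1) := by ring
    rw [e, e2]; linarith


/-- Maximization of the lift-one objective `g(x) = a·x·(1-x)^(p-1) + b·(1-x)^p`
on `[0,1]`: if `a > p·b` the maximizer is `x* = (a - p·b)/(p·(a - b)) ∈ (0,1)`;
otherwise `g(0)` is maximal. -/
theorem liftone_objective_max
    {p : ℕ} (hp : 2 ≤ p) (a b : ℝ) (ha : 0 ≤ a) (hb : 0 < b)
    (g : ℝ → ℝ) (hg : ∀ x, g x = a * x * (1 - x) ^ (p - 1) + b * (1 - x) ^ p) :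
    ((p : ℝ) * b < a →
      (a - (p : ℝ) * b) / ((p : ℝ) * (a - b)) ∈ Set.Ioo (0 : ℝ) 1 ∧
        ∀ x ∈ Set.Icc (0 : ℝ) 1, g x ≤ g ((a - (p : ℝ) * b) / ((p : ℝ) * (a - b)))) ∧
    (a ≤ (p : ℝ) * b → ∀ x ∈ Set.Icc (0 : ℝ) 1, g x ≤ g 0) := by
  obtain ⟨n, rfl⟩ : ∃ n, p = n + 1 := ⟨p - 1, by omega⟩
  have hn : (1 : ℝ) ≤ n := by exact_mod_cast (by omega : 1 ≤ n)
  have hn0 : (0 : ℝ) < n := by linarith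
  simp only [Nat.add_sub_cancel] at hg
  push_cast
  constructor
  · intro h
    have hnb : 0 < (n : ℝ) * b := by positivity
    have hc : 0 < a - b := by nlinarith
    have ha' : 0 < a := by linarith
    have hpc : 0 < ((n : ℝ) + 1) * (a - b) := by positivity
    obtain ⟨t, htdef⟩ : ∃ t, t = n * a / (((n : ℝ) + 1) * (a - b)) := ⟨_, rfl⟩
    have ht : 0 < t := by rw [htdef]; positivity
    have hta : ((n : ℝ) + 1) * (a - b) * t = n * a := by rw [htdef]; field_simp
    have hx : (a - ((n : ℝ) + 1) * b) / (((n : ℝ) + 1) * (a - b)) = 1 - t := by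
      rw [div_eq_iff hpc.ne']; linarith
    have key : ∀ x, n * g x = (a - b) * ((1 - x) ^ n * ((n + 1) * t - n * (1 - x))) := by
      intro x
      rw [hg, pow_succ]
      linear_combination (-(1 - x) ^ n) * hta
    constructor
    · refine ⟨div_pos (by linarith) hpc, ?_⟩
      rw [hx]; linarith
    · rintro x ⟨h0, h1⟩
      rw [hx]
      refine le_of_mul_le_mul_left ?_ hn0
      rw [key, key]
      refine mul_le_mul_of_nonneg_left ?_ hc.le
      refine (liftone_young n (1 - x) t (by linarith) ht.le).trans (le_of_eq ?_)
      rw [sub_sub_cancel]; ring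
  · rintro h x ⟨h0, h1⟩
    have hy := liftone_young n (1 - x) 1 (by linarith) zero_le_one
    rw [one_pow] at hy
    have h2 := mul_le_mul_of_nonneg_left hy hb.le
    have h3 : 0 ≤ (((n : ℝ) + 1) * b - a) * (x * (1 - x) ^ n) :=
      mul_nonneg (by linarith) (mul_nonneg h0 (pow_nonneg (by linarith) _))
    have h4 : g 0 = b := by rw [hg]; simp
    rw [h4, hg, pow_succ]
    linarith
end

section
/- Let J ≥ 2 and let γ_1, …, γ_{J−1} be real numbers; set γ_0 = 0 and γ_J = 1, and define π_j = γ_j − γ_{j−1} for j = 1, …, J, assuming π_j ≠ 0 for all j. Let V be the (J−1)×(J−1) symmetric tridiagonal real matrix with diagonal entries V_{ss} = γ_s²·(1−γ_s)²·(1/π_s + 1/π_{s+1}) for 1 ≤ s ≤ J−1, off-diagonal entries V_{s,s+1} = V_{s+1,s} = −γ_s·γ_{s+1}·(1−γ_s)·(1−γ_{s+1})/π_{s+1} for 1 ≤ s ≤ J−2, and all other entries zero. Then det V = (Π_{j=1}^{J−1} γ_j·(1−γ_j))² / (Π_{j=1}^{J} π_j). -/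
open Matrix

/-- symmetric tridiagonal matrix -/
def tridiagAux (n : ℕ) (a b : ℕ → ℝ) : Matrix (Fin n) (Fin n) ℝ :=
  Matrix.of fun i j => if (i : ℕ) = j then a i else if (j : ℕ) = i + 1 then b i
    else if (i : ℕ) = j + 1 then b j else 0

lemma tridiagAux_rec (n : ℕ) (a b : ℕ → ℝ) :
    (tridiagAux (n + 2) a b).det = a 0 * (tridiagAux (n + 1) (fun k => a (k + 1)) (fun k => b (k + 1))).det
      - b 0 ^ 2 * (tridiagAux n (fun k => a (k + 2)) (fun k => b (k + 2))).det := by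
  have h1 : (tridiagAux (n + 2) a b).submatrix Fin.succ (Fin.succAbove 0)
      = tridiagAux (n + 1) (fun k => a (k + 1)) (fun k => b (k + 1)) := by
    ext i j
    simp [tridiagAux]
  have h2 : ((tridiagAux (n + 2) a b).submatrix Fin.succ (Fin.succAbove (Fin.succ 0))).det
      = b 0 * (tridiagAux n (fun k => a (k + 2)) (fun k => b (k + 2))).det := by
    rw [Matrix.det_succ_column_zero, Fin.sum_univ_succ, Finset.sum_eq_zero]
    · have h3 : ((tridiagAux (n + 2) a b).submatrix Fin.succ (Fin.succAbove (Fin.succ 0))).submatrix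
          (Fin.succAbove 0) Fin.succ = tridiagAux n (fun k => a (k + 2)) (fun k => b (k + 2)) := by
        ext i j
        simp [tridiagAux]
      rw [h3]
      simp [tridiagAux]
    · intro i _
      simp [tridiagAux]
  rw [Matrix.det_succ_row_zero, Fin.sum_univ_succ, Fin.sum_univ_succ, Finset.sum_eq_zero, h1, h2]
  · simp [tridiagAux]
    ring
  · intro i _
    simp [tridiagAux]

lemma tridiagAux_det (n : ℕ) : ∀ (c p : ℕ → ℝ), (∀ j, j ≤ n → p j ≠ 0) →
    (tridiagAux n (fun k => c k ^ 2 * (1 / p k + 1 / p (k + 1)))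
      (fun k => -(c k * c (k + 1) / p (k + 1)))).det
    = (∏ j ∈ Finset.range n, c j) ^ 2 * (∑ j ∈ Finset.range (n + 1), p j) /
      ∏ j ∈ Finset.range (n + 1), p j := by
  induction n using Nat.strong_induction_on with
  | _ n ih =>
    intro c p hp
    match n, ih, hp with
    | 0, _, hp =>
      have := hp 0 le_rfl
      simp [this]
    | 1, _, hp =>
      have h0 := hp 0 (by simp)
      have h1 := hp 1 le_rfl
      simp [tridiagAux, Finset.sum_range_succ, Finset.prod_range_succ]
      field_simp
      ring
    | n + 2, ih, hp =>
      have e1 := ih (n + 1) (by omega) (fun k => c (k + 1)) (fun k => p (k + 1))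
        (fun j hj => hp _ (by omega))
      have e2 := ih n (by omega) (fun k => c (k + 2)) (fun k => p (k + 2))
        (fun j hj => hp _ (by omega))
      have h0 := hp 0 (by simp)
      have h1 := hp 1 (by simp)
      have hP : ∏ j ∈ Finset.range (n + 1), p (j + 2) ≠ 0 :=
        Finset.prod_ne_zero_iff.2 fun j hj => hp _ (by have := Finset.mem_range.1 hj; omega)
      rw [tridiagAux_rec]
      refine (congrArg₂ (fun x y => _ * x - _ * y) e1 e2).trans ?_
      simp only [Finset.prod_range_succ' _ (n + 1), Finset.prod_range_succ' _ (n + 1 + 1),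
        Finset.sum_range_succ' _ (n + 1), Finset.sum_range_succ' _ (n + 1 + 1),
        Finset.prod_range_succ' (fun k => c (k + 1)) n, add_assoc, Nat.reduceAdd, zero_add]
      generalize ∏ j ∈ Finset.range (n + 1), p (j + 2) = P at *
      generalize ∑ j ∈ Finset.range (n + 1), p (j + 2) = S at *
      generalize ∏ j ∈ Finset.range n, c (j + 2) = C at *
      field_simp
      ring


/-- Determinant of the tridiagonal cumulative-logit information kernel `V`:
with cumulative probabilities `γ₀ = 0 < … < γ_J = 1` (here arbitrary reals with
`γ₀ = 0`, `γ_J = 1`) and category probabilities `πⱼ = γⱼ - γ_{j-1} ≠ 0`,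
`det V = (∏_{j=1}^{J-1} γⱼ(1-γⱼ))² / ∏_{j=1}^{J} πⱼ`. -/
theorem det_cumulative_logit_kernel
    {J : ℕ} (hJ : 2 ≤ J) (γ : ℕ → ℝ) (hγ0 : γ 0 = 0) (hγJ : γ J = 1)
    (π : ℕ → ℝ) (hπ : ∀ j, 1 ≤ j → π j = γ j - γ (j - 1))
    (hπne : ∀ j, 1 ≤ j → j ≤ J → π j ≠ 0)
    (V : Matrix (Fin (J - 1)) (Fin (J - 1)) ℝ)
    (hVdiag : ∀ i : Fin (J - 1), V i i =
      γ ((i : ℕ) + 1) ^ 2 * (1 - γ ((i : ℕ) + 1)) ^ 2 *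
        (1 / π ((i : ℕ) + 1) + 1 / π ((i : ℕ) + 2)))
    (hVsup : ∀ i j : Fin (J - 1), (j : ℕ) = (i : ℕ) + 1 →
      V i j = -(γ ((i : ℕ) + 1) * γ ((i : ℕ) + 2) * (1 - γ ((i : ℕ) + 1)) *
        (1 - γ ((i : ℕ) + 2)) / π ((i : ℕ) + 2)))
    (hVsub : ∀ i j : Fin (J - 1), (i : ℕ) = (j : ℕ) + 1 →
      V i j = -(γ ((j : ℕ) + 1) * γ ((j : ℕ) + 2) * (1 - γ ((j : ℕ) + 1)) *
        (1 - γ ((j : ℕ) + 2)) / π ((j : ℕ) + 2)))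
    (hVzero : ∀ i j : Fin (J - 1), (i : ℕ) ≠ (j : ℕ) →
      (i : ℕ) ≠ (j : ℕ) + 1 → (j : ℕ) ≠ (i : ℕ) + 1 → V i j = 0) :
    V.det = (∏ j ∈ Finset.range (J - 1), γ (j + 1) * (1 - γ (j + 1))) ^ 2 /
      ∏ j ∈ Finset.range J, π (j + 1) := by
  obtain ⟨n, rfl⟩ : ∃ n, J = n + 1 := ⟨J - 1, by omega⟩
  simp only [Nat.add_sub_cancel] at *
  have hs : ∑ j ∈ Finset.range (n + 1), π (j + 1) = 1 := by
    rw [Finset.sum_congr rfl fun j _ => hπ (j + 1) (by omega)]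
    simp only [Nat.add_sub_cancel]
    rw [Finset.sum_range_sub, hγ0, hγJ, sub_zero]
  have key := tridiagAux_det n (fun j => γ (j + 1) * (1 - γ (j + 1))) (fun j => π (j + 1))
    (fun j hj => hπne _ (by omega) (by omega))
  rw [hs, mul_one] at key
  rw [← key]
  congr 1
  ext i j
  simp only [tridiagAux, Matrix.of_apply]
  split_ifs with h1 h2 h3
  · obtain rfl := Fin.ext h1
    rw [hVdiag]
    ring
  · rw [hVsup i j h2]
    ring
  · rw [hVsub i j h3]
    ring
  · exact hVzero i j h1 h3 h2
end
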